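/- For every random cover Q of E and every m ∈ ℕ, the relative tail entropy of the m-th power system with respect to Q^{(m)} satisfies h(Θ^m | Q^{(m)}) = m·h(Θ | Q). -/

import Mathlib

open MeasureTheory Set Filter Topology
open scoped ENNReal

namespace RelTail

variable {Ω W : Type*}

/-- The fiber over `ω` of a subset of a product space. -/
def fib (E : Set (Ω × W)) (ω : Ω) : Set W := {x | (ω, x) ∈ E}

/-- Minimal cardinality of a subfamily of the cover `R` whose fibers at `ω` cover the
fiber of `S` at `ω` (with the convention that the empty set needs one element). -/
noncomputable def coverNum (S : Set (Ω × W)) (R : Set (Set (Ω × W))) (ω : Ω) : ℕ :=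
  max 1 (sInf {n : ℕ | ∃ F : Finset (Set (Ω × W)), ↑F ⊆ R ∧ F.card = n ∧
    fib S ω ⊆ ⋃ u ∈ F, fib u ω})

/-- `N(R | Q)(ω) = max_{q ∈ Q} N(q, R)(ω)`. -/
noncomputable def relCoverNum (R Q : Set (Set (Ω × W))) (ω : Ω) : ℕ :=
  ⨆ q ∈ Q, coverNum q R ω

section Meas
variable [MeasurableSpace Ω] [MeasurableSpace W]

/-- A (finite or countable) random cover of `E`. -/
def IsRandomCover (E : Set (Ω × W)) (Q : Set (Set (Ω × W))) : Prop :=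
  Q.Countable ∧ (∀ q ∈ Q, MeasurableSet q) ∧ (∀ q ∈ Q, q ⊆ E) ∧
    ∀ ω, fib E ω ⊆ ⋃ q ∈ Q, fib q ω

/-- An open random cover: a random cover whose fibers are (a.e.) open in the fibers of `E`. -/
def IsOpenRandomCover [TopologicalSpace W] (P : Measure Ω) (E : Set (Ω × W))
    (Q : Set (Set (Ω × W))) : Prop :=
  IsRandomCover E Q ∧
    ∀ q ∈ Q, ∀ᵐ ω ∂P, ∃ U : Set W, IsOpen U ∧ fib q ω = U ∩ fib E ω

end Meas

/-- The join `⋁_{i<n} (Γ^i)^{-1} Q` of a cover (or partition). -/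
def iterJoin {Z : Type*} (Γ : Z → Z) (Q : Set (Set Z)) (n : ℕ) : Set (Set Z) :=
  {s | ∃ f : ℕ → Set Z, (∀ i, f i ∈ Q) ∧ s = ⋂ i ∈ Finset.range n, (Γ^[i]) ⁻¹' (f i)}

/-- `log N(R^{(n)} | Q^{(n)})(ω)`. -/
noncomputable def iterCoverLog (Θ : Ω × W → Ω × W) (R Q : Set (Set (Ω × W))) (n : ℕ)
    (ω : Ω) : ℝ :=
  Real.log (relCoverNum (iterJoin Θ R n) (iterJoin Θ Q n) ω)

/-- The relative tail entropy `h_Θ(R|Q)` of an open random cover `R` w.r.t. a random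
cover `Q`, as a limit (limsup) of `(1/n) ∫ log N(R^{(n)}|Q^{(n)}) dP`. -/
noncomputable def relCoverEnt [MeasurableSpace Ω] (P : Measure Ω) (Θ : Ω × W → Ω × W)
    (R Q : Set (Set (Ω × W))) : ℝ≥0∞ :=
  Filter.atTop.limsup fun n : ℕ => ENNReal.ofReal ((∫ ω, iterCoverLog Θ R Q n ω ∂P) / n)

/-- `h(Θ|Q)`: supremum over all open random covers `R` of `h_Θ(R|Q)`. -/
noncomputable def condTailEnt [MeasurableSpace Ω] [MeasurableSpace W] [TopologicalSpace W]
    (P : Measure Ω) (E : Set (Ω × W)) (Θ : Ω × W → Ω × W) (Q : Set (Set (Ω × W))) : ℝ≥0∞ :=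
  ⨆ R ∈ {R | IsOpenRandomCover P E R}, relCoverEnt P Θ R Q

/-- The relative tail entropy `h*(Θ)`: infimum over all random covers `Q` of `h(Θ|Q)`. -/
noncomputable def tailEnt [MeasurableSpace Ω] [MeasurableSpace W] [TopologicalSpace W]
    (P : Measure Ω) (E : Set (Ω × W)) (Θ : Ω × W → Ω × W) : ℝ≥0∞ :=
  ⨅ Q ∈ {Q | IsRandomCover E Q}, condTailEnt P E Θ Q

/-- The skew product transformation of a bundle RDS. -/
def skew (ϑ : Ω → Ω) (T : Ω → W → W) : Ω × W → Ω × W := fun p => (ϑ p.1, T p.1 p.2)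

/-- A continuous bundle random dynamical system over `(Ω, P, ϑ)` on `E`. -/
structure IsBundleRDS [MeasurableSpace Ω] [MeasurableSpace W] [TopologicalSpace W]
    (P : Measure Ω) (ϑ : Ω → Ω) (E : Set (Ω × W)) (T : Ω → W → W) : Prop where
  measurePreserving : MeasurePreserving ϑ P P
  measurable : Measurable fun p : Ω × W => T p.1 p.2
  mapsTo : ∀ ω, MapsTo (T ω) (fib E ω) (fib E (ϑ ω))
  continuousOn : ∀ᵐ ω ∂P, ContinuousOn (T ω) (fib E ω)

/-- A finite or countable measurable partition of a set `E`. -/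
def IsCountablePartition {Z : Type*} [MeasurableSpace Z] (E : Set Z) (R : Set (Set Z)) : Prop :=
  R.Countable ∧ (∀ s ∈ R, MeasurableSet s) ∧ (∀ s ∈ R, s ⊆ E) ∧
    R.PairwiseDisjoint id ∧ ⋃₀ R = E

/-- The conditional entropy `H_μ(R | m)` of a countable partition `R` given a
sub-σ-algebra `m`, via conditional expectations. -/
noncomputable def partCondEntropy {Z : Type*} (m : MeasurableSpace Z) [MeasurableSpace Z]
    (μ : Measure Z) (R : Set (Set Z)) : ℝ≥0∞ :=
  ∑' r : R, ENNReal.ofReal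
    (∫ z, Real.negMulLog ((μ[(r : Set Z).indicator (fun _ => (1 : ℝ)) | m]) z) ∂μ)

/-- The relative entropy `h_μ(R | m)` of the transformation `Γ` with respect to a
partition `R`, given the sub-σ-algebra `m`. -/
noncomputable def relEntPart {Z : Type*} (m : MeasurableSpace Z) [MeasurableSpace Z]
    (μ : Measure Z) (Γ : Z → Z) (R : Set (Set Z)) : ℝ≥0∞ :=
  Filter.atTop.limsup fun n : ℕ => partCondEntropy m μ (iterJoin Γ R n) / (n : ℝ≥0∞)

/-- The relative entropy `h_μ(Γ | m)` given the sub-σ-algebra `m`: supremum over all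
countable measurable partitions of `E` of finite conditional entropy. -/
noncomputable def relEnt {Z : Type*} (m : MeasurableSpace Z) [MeasurableSpace Z]
    (μ : Measure Z) (Γ : Z → Z) (E : Set Z) : ℝ≥0∞ :=
  ⨆ R ∈ {R | IsCountablePartition E R ∧ partCondEntropy m μ R ≠ ∞}, relEntPart m μ Γ R

/-- The fiberwise boundary `{(ω,x) : x ∈ ∂(R(ω))}` of a subset of a product space. -/
def fibFrontier [TopologicalSpace W] (R : Set (Ω × W)) : Set (Ω × W) :=
  {p | p.2 ∈ frontier (fib R p.1)}

/-- The sub-σ-algebra of `Ω × W₁ × W₂` generated by the first two coordinates,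
i.e. the σ-algebra `{(A × W₂) ∩ ⬝ : A ∈ F × B}`. -/
def firstPairSigma (Ω W₁ W₂ : Type*) [MeasurableSpace Ω] [MeasurableSpace W₁] :
    MeasurableSpace (Ω × W₁ × W₂) :=
  MeasurableSpace.comap (fun p : Ω × W₁ × W₂ => (p.1, p.2.1)) inferInstance

/-- The defect of upper semi-continuity of `f` at `m` relative to the set `S`. -/
noncomputable def uscDefect {M : Type*} [TopologicalSpace M] (f : M → ℝ≥0∞) (S : Set M)
    (m : M) : ℝ≥0∞ :=
  if f m ≠ ∞ then Filter.limsup f (𝓝[S] m) - f m else ∞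

/-- The factor (extension) transformation `(ω, y) ↦ (ω, π_ω y)`. -/
def factorMap {Y X : Type*} (πf : Ω → Y → X) : Ω × Y → Ω × X :=
  fun p => (p.1, πf p.1 p.2)

/-- `T` on `E` is a factor of `S` on `G` via the family `π_ω`. -/
structure IsFactor {Ω X Y : Type*} [MeasurableSpace Ω] [MeasurableSpace X] [MeasurableSpace Y]
    [TopologicalSpace X] [TopologicalSpace Y] (ϑ : Ω → Ω) (E : Set (Ω × X)) (G : Set (Ω × Y))
    (T : Ω → X → X) (S : Ω → Y → Y) (πf : Ω → Y → X) : Prop where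
  measurable : Measurable fun p : Ω × Y => πf p.1 p.2
  mapsTo : ∀ ω, MapsTo (πf ω) (fib G ω) (fib E ω)
  surjOn : ∀ ω, SurjOn (πf ω) (fib G ω) (fib E ω)
  continuousOn : ∀ ω, ContinuousOn (πf ω) (fib G ω)
  semiconj : ∀ ω, ∀ y ∈ fib G ω, πf (ϑ ω) (S ω y) = T ω (πf ω y)

theorem open_superset_box (n : ℕ → ℕ) (V : Set (ℕ → ℕ)) (hV : IsOpen V)
    (hK : {x : ℕ → ℕ | ∀ i, x i ≤ n i} ⊆ V) :
    ∃ k, {x : ℕ → ℕ | ∀ i < k, x i ≤ n i} ⊆ V := by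
  classical
  have hKc : IsCompact {x : ℕ → ℕ | ∀ i, x i ≤ n i} := by
    have h : {x : ℕ → ℕ | ∀ i, x i ≤ n i} = Set.pi univ (fun i => Set.Iic (n i)) := by
      ext x; simp [Pi.le_def]
    rw [h]
    exact isCompact_univ_pi fun i => (Set.finite_Iic (n i)).isCompact
  have h1 : ∀ x ∈ {x : ℕ → ℕ | ∀ i, x i ≤ n i}, ∃ k, PiNat.cylinder x k ⊆ V := by
    intro x hx
    obtain ⟨_, ⟨y, k, rfl⟩, hx', hs⟩ :=
      (PiNat.isTopologicalBasis_cylinders (fun _ : ℕ => ℕ)).exists_subset_of_mem_open (hK hx) hV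
    refine ⟨k, ?_⟩
    rwa [PiNat.mem_cylinder_iff_eq.1 hx']
  choose! k hk using h1
  obtain ⟨t, htK, ht⟩ := hKc.elim_nhds_subcover (fun x => PiNat.cylinder x (k x))
    (fun x _ => (PiNat.isOpen_cylinder _ x (k x)).mem_nhds (PiNat.self_mem_cylinder x _))
  refine ⟨t.sup k, fun x hx => ?_⟩
  have hy : (fun i => min (x i) (n i)) ∈ {x : ℕ → ℕ | ∀ i, x i ≤ n i} := fun i => min_le_right _ _
  have := ht hy
  simp only [mem_iUnion] at this
  obtain ⟨z, hz, hyz⟩ := this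
  refine hk z (htK z hz) ?_
  intro i hi
  have h2 := hyz i hi
  have h3 := hx i (lt_of_lt_of_le hi (Finset.le_sup (f := k) hz))
  simp only at h2
  rwa [min_eq_left h3] at h2

theorem analytic_nullMeasurable {Y : Type*} [TopologicalSpace Y] [T2Space Y] [MeasurableSpace Y]
    [BorelSpace Y] (μ : Measure Y) [IsFiniteMeasure μ] [μ.OuterRegular] (s : Set Y)
    (hs : AnalyticSet s) : NullMeasurableSet s μ := by
  rw [AnalyticSet] at hs
  rcases hs with rfl | ⟨g, hg, rfl⟩
  · exact MeasurableSet.empty.nullMeasurableSet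
  set a := μ (range g) with ha
  have key : ∀ b < a, ∃ K : Set Y, MeasurableSet K ∧ K ⊆ range g ∧ b ≤ μ K := by
    intro b hb
    let B : List ℕ → Set (ℕ → ℕ) := fun l => {x | ∀ i, ∀ h : i < l.length, x i ≤ l[i]}
    have step : ∀ l : List ℕ, b < μ (g '' B l) → ∃ j, b < μ (g '' B (l ++ [j])) := by
      intro l hl
      have hU : g '' B l = ⋃ j, g '' B (l ++ [j]) := by
        rw [← image_iUnion]
        congr 1
        ext x
        simp only [mem_iUnion]
        constructor
        · intro hx
          refine ⟨x l.length, fun i h => ?_⟩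
          by_cases h' : i < l.length
          · rw [List.getElem_append_left h']; exact hx i h'
          · have : i = l.length := by simp at h; omega
            subst this; simp
        · rintro ⟨j, hj⟩ i h
          have := hj i (by simp; omega)
          rwa [List.getElem_append_left h] at this
      have hm : Monotone fun j => g '' B (l ++ [j]) := by
        intro j j' hjj
        refine image_mono fun x hx i h => ?_
        have h0 := hx i (by simpa using h)
        by_cases h' : i < l.length
        · rw [List.getElem_append_left h'] at h0 ⊢; exact h0
        · have : i = l.length := by simp at h; omega
          subst this; simp at h0 ⊢; omega
      rw [hU, hm.measure_iUnion] at hl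
      exact lt_iSup_iff.1 hl
    choose! nx hnx using step
    let L : ℕ → List ℕ := fun k => Nat.rec [] (fun _ l => l ++ [nx l]) k
    have hL0 : L 0 = [] := rfl
    have hLs : ∀ k, L (k+1) = L k ++ [nx (L k)] := fun k => rfl
    have hlen : ∀ k, (L k).length = k := by
      intro k; induction k with
      | zero => rfl
      | succ k ih => rw [hLs]; simp [ih]
    have hbL : ∀ k, b < μ (g '' B (L k)) := by
      intro k; induction k with
      | zero =>
        have : B (L 0) = univ := by ext x; simp [B, hL0]
        rw [this, image_univ]; exact hb
      | succ k ih => rw [hLs]; exact hnx _ ih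
    let n : ℕ → ℕ := fun i => nx (L i)
    have hget : ∀ k i, ∀ h : i < (L k).length, (L k)[i] = n i := by
      intro k; induction k with
      | zero => intro i h; simp [hL0] at h
      | succ k ih =>
        intro i h
        simp only [hLs]
        by_cases h' : i < (L k).length
        · rw [List.getElem_append_left h']; exact ih i h'
        · have : i = (L k).length := by simp [hLs] at h; omega
          subst this; simp [n, hlen]
    have hB : ∀ k, B (L k) = {x : ℕ → ℕ | ∀ i < k, x i ≤ n i} := by
      intro k; ext x
      constructor
      · intro hx i hi
        have := hx i (by rw [hlen]; exact hi)
        rwa [hget] at this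
      · intro hx i hi
        rw [hget]; exact hx i (by rw [hlen] at hi; exact hi)
    have hKc : IsCompact {x : ℕ → ℕ | ∀ i, x i ≤ n i} := by
      have h : {x : ℕ → ℕ | ∀ i, x i ≤ n i} = Set.pi univ (fun i => Set.Iic (n i)) := by
        ext x; simp [Pi.le_def]
      rw [h]
      exact isCompact_univ_pi fun i => (Set.finite_Iic (n i)).isCompact
    refine ⟨g '' {x : ℕ → ℕ | ∀ i, x i ≤ n i}, (hKc.image hg).measurableSet,
      image_subset_range _ _, ?_⟩
    rw [Set.measure_eq_iInf_isOpen]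
    refine le_iInf fun U => le_iInf fun hKU => le_iInf fun hU => ?_
    obtain ⟨k, hk⟩ := open_superset_box n (g ⁻¹' U) (hU.preimage hg) (image_subset_iff.1 hKU)
    rw [← hB] at hk
    exact (hbL k).le.trans (measure_mono (image_subset_iff.2 hk))
  by_cases ha0 : a = 0
  · exact NullMeasurableSet.of_null (ha ▸ ha0)
  obtain ⟨u, -, hu, hul⟩ := exists_seq_strictMono_tendsto' (pos_iff_ne_zero.2 ha0)
  choose K hKm hKs hKb using fun j => key (u j) (hu j).2
  have hM : MeasurableSet (⋃ j, K j) := MeasurableSet.iUnion hKm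
  have hsub : (⋃ j, K j) ⊆ range g := iUnion_subset hKs
  have hle : μ (range g) ≤ μ (⋃ j, K j) :=
    le_of_tendsto' hul fun j => (hKb j).trans (measure_mono (subset_iUnion K j))
  have : (⋃ j, K j) =ᵐ[μ] range g :=
    ae_eq_of_subset_of_measure_ge hsub hle hM.nullMeasurableSet (measure_ne_top _ _)
  exact hM.nullMeasurableSet.congr this

theorem polish_cantor : PolishSpace (ℕ → Bool) := by
  let : MetricSpace (ℕ → Bool) := TopologicalSpace.metrizableSpaceMetric _
  infer_instance

theorem proj_measurable {Ω X : Type*} [mΩ : MeasurableSpace Ω]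
    [MeasurableSpace.CountablyGenerated Ω]
    [MetricSpace X] [CompactSpace X] [mX : MeasurableSpace X] [BorelSpace X]
    (P : Measure Ω) [IsProbabilityMeasure P] [P.IsComplete] (A : Set (Ω × X))
    (hA : MeasurableSet A) : MeasurableSet (Prod.fst '' A) := by
  let g : Ω → (ℕ → Bool) := MeasurableSpace.mapNatBool Ω
  have hg : Measurable g := MeasurableSpace.measurable_mapNatBool Ω
  have hcomap : mΩ ≤ MeasurableSpace.comap g inferInstance := by
    conv_lhs => rw [← MeasurableSpace.generateFrom_natGeneratingSequence Ω]
    refine MeasurableSpace.generateFrom_le ?_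
    rintro _ ⟨n, rfl⟩
    refine ⟨(fun x => x n) ⁻¹' {true}, (measurable_pi_apply n) (measurableSet_singleton _), ?_⟩
    ext x
    simp [g, MeasurableSpace.mapNatBool]
  have hprod : (inferInstance : MeasurableSpace (Ω × X)) ≤
      MeasurableSpace.comap (Prod.map g (id : X → X)) inferInstance := by
    refine sup_le ?_ ?_
    · refine (MeasurableSpace.comap_mono hcomap).trans ?_
      rw [MeasurableSpace.comap_comp]
      have : g ∘ Prod.fst = Prod.fst ∘ Prod.map g (id : X → X) := rfl
      rw [this, ← MeasurableSpace.comap_comp]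
      exact MeasurableSpace.comap_mono measurable_fst.comap_le
    · have : (Prod.snd : Ω × X → X) = Prod.snd ∘ Prod.map g (id : X → X) := rfl
      rw [this, ← MeasurableSpace.comap_comp]
      exact MeasurableSpace.comap_mono measurable_snd.comap_le
  obtain ⟨A', hA', rfl⟩ := hprod A hA
  have himg : Prod.fst '' (Prod.map g (id : X → X) ⁻¹' A') = g ⁻¹' (Prod.fst '' A') := by
    ext ω
    constructor
    · rintro ⟨⟨ω', x⟩, h, rfl⟩
      exact ⟨(g ω', x), h, rfl⟩
    · rintro ⟨⟨y, x⟩, h, hy⟩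
      refine ⟨(ω, x), ?_, rfl⟩
      simp only at hy
      subst hy
      exact h
  rw [himg]
  have : SecondCountableTopology X := inferInstance
  have : CompleteSpace X := inferInstance
  have : PolishSpace X := inferInstance
  have : PolishSpace (ℕ → Bool) := polish_cantor
  have : PolishSpace ((ℕ → Bool) × X) := inferInstance
  have han : AnalyticSet (Prod.fst '' A') := hA'.analyticSet.image_of_continuous continuous_fst
  have : IsProbabilityMeasure (P.map g) := Measure.isProbabilityMeasure_map hg.aemeasurable
  have h0 : NullMeasurableSet (Prod.fst '' A') (P.map g) := analytic_nullMeasurable _ _ han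
  exact (h0.preimage (⟨hg, Measure.AbsolutelyContinuous.rfl⟩)).measurable_of_complete

/-- `S` can be covered over `ω` by at most `k` members of `R`. -/
def CovBy {Ω W : Type*} (S : Set (Ω × W)) (R : Set (Set (Ω × W))) (ω : Ω) (k : ℕ) : Prop :=
  ∃ F : Finset (Set (Ω × W)), ↑F ⊆ R ∧ F.card ≤ k ∧ ∀ x, (ω, x) ∈ S → ∃ u ∈ F, (ω, x) ∈ u

/-- Every member of `Q` can be covered over `ω` by at most `k` members of `R`. -/
def RelCovBy {Ω W : Type*} (R Q : Set (Set (Ω × W))) (ω : Ω) (k : ℕ) : Prop :=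
  ∀ q ∈ Q, CovBy q R ω k

theorem CovBy.mono {Ω W : Type*} {S : Set (Ω × W)} {R : Set (Set (Ω × W))} {ω : Ω} {k l : ℕ}
    (h : CovBy S R ω k) (hkl : k ≤ l) : CovBy S R ω l := by
  obtain ⟨F, h1, h2, h3⟩ := h
  exact ⟨F, h1, h2.trans hkl, h3⟩

theorem CovBy.mono_left {Ω W : Type*} {S S' : Set (Ω × W)} {R : Set (Set (Ω × W))} {ω : Ω} {k : ℕ}
    (h : CovBy S R ω k) (hS : S' ⊆ S) : CovBy S' R ω k := by
  obtain ⟨F, h1, h2, h3⟩ := h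
  exact ⟨F, h1, h2, fun x hx => h3 x (hS hx)⟩

theorem CovBy.refine {Ω W : Type*} {S : Set (Ω × W)} {R R' : Set (Set (Ω × W))} {ω : Ω} {k : ℕ}
    (h : CovBy S R ω k) (hR : ∀ u ∈ R, ∃ u' ∈ R', u ⊆ u') : CovBy S R' ω k := by
  classical
  obtain ⟨F, h1, h2, h3⟩ := h
  choose! g hg1 hg2 using hR
  refine ⟨F.image g, ?_, Finset.card_image_le.trans h2, fun x hx => ?_⟩
  · intro u hu
    simp only [Finset.coe_image, mem_image] at hu
    obtain ⟨v, hv, rfl⟩ := hu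
    exact hg1 v (h1 hv)
  · obtain ⟨u, hu, hxu⟩ := h3 x hx
    exact ⟨g u, Finset.mem_image_of_mem g hu, hg2 u (h1 hu) hxu⟩

theorem coverNum_eq {Ω W : Type*} (S : Set (Ω × W)) (R : Set (Set (Ω × W))) (ω : Ω) :
    coverNum S R ω = max 1 (sInf {k : ℕ | CovBy S R ω k}) := by
  unfold coverNum
  congr 1
  have hiff : ∀ F : Finset (Set (Ω × W)), (fib S ω ⊆ ⋃ u ∈ F, fib u ω) ↔
      ∀ x, (ω, x) ∈ S → ∃ u ∈ F, (ω, x) ∈ u := by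
    intro F
    constructor
    · intro h x hx
      have := h hx
      simp only [mem_iUnion] at this
      obtain ⟨u, hu, hxu⟩ := this
      exact ⟨u, hu, hxu⟩
    · intro h x hx
      obtain ⟨u, hu, hxu⟩ := h x hx
      simp only [mem_iUnion]
      exact ⟨u, hu, hxu⟩
  simp only [hiff]
  by_cases hne : {k : ℕ | CovBy S R ω k}.Nonempty
  · apply le_antisymm
    · obtain ⟨F, h1, h2, h3⟩ := Nat.sInf_mem hne
      refine le_trans (Nat.sInf_le (m := F.card) ?_) h2
      exact ⟨F, h1, rfl, h3⟩
    · obtain ⟨k, F, h1, h2, h3⟩ := hne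
      have : {n : ℕ | ∃ F : Finset (Set (Ω × W)), ↑F ⊆ R ∧ F.card = n ∧
          ∀ x, (ω, x) ∈ S → ∃ u ∈ F, (ω, x) ∈ u}.Nonempty := ⟨F.card, F, h1, rfl, h3⟩
      obtain ⟨F', h1', h2', h3'⟩ := Nat.sInf_mem this
      exact Nat.sInf_le ⟨F', h1', h2'.le, h3'⟩
  · have e1 : {k : ℕ | CovBy S R ω k} = ∅ := not_nonempty_iff_eq_empty.1 hne
    have e2 : {n : ℕ | ∃ F : Finset (Set (Ω × W)), ↑F ⊆ R ∧ F.card = n ∧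
          ∀ x, (ω, x) ∈ S → ∃ u ∈ F, (ω, x) ∈ u} = ∅ := by
      rw [← not_nonempty_iff_eq_empty]
      rintro ⟨n, F, h1, h2, h3⟩
      exact hne ⟨n, F, h1, h2.le, h3⟩
    rw [e1, e2]

theorem coverNum_le {Ω W : Type*} {S : Set (Ω × W)} {R : Set (Set (Ω × W))} {ω : Ω} {k : ℕ}
    (h : CovBy S R ω k) : coverNum S R ω ≤ max 1 k := by
  rw [coverNum_eq]
  exact max_le_max le_rfl (Nat.sInf_le h)

theorem covBy_coverNum {Ω W : Type*} {S : Set (Ω × W)} {R : Set (Set (Ω × W))} {ω : Ω} {k : ℕ}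
    (h : CovBy S R ω k) : CovBy S R ω (coverNum S R ω) := by
  rw [coverNum_eq]
  exact CovBy.mono (Nat.sInf_mem (s := {k : ℕ | CovBy S R ω k}) ⟨k, h⟩) (le_max_right _ _)

theorem relCoverNum_le {Ω W : Type*} {R Q : Set (Set (Ω × W))} {ω : Ω} {k : ℕ}
    (h : RelCovBy R Q ω k) : relCoverNum R Q ω ≤ max 1 k := by
  unfold relCoverNum
  refine ciSup_le' fun q => ciSup_le' fun hq => coverNum_le (h q hq)

theorem relCovBy_relCoverNum {Ω W : Type*} {R Q : Set (Set (Ω × W))} {ω : Ω} {k : ℕ}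
    (h : RelCovBy R Q ω k) : RelCovBy R Q ω (relCoverNum R Q ω) := by
  intro q hq
  refine (covBy_coverNum (h q hq)).mono ?_
  unfold relCoverNum
  have hb : BddAbove (range fun q => ⨆ (_ : q ∈ Q), coverNum q R ω) := by
    refine ⟨max 1 k, ?_⟩
    rintro _ ⟨q', rfl⟩
    exact ciSup_le' fun hq' => coverNum_le (h q' hq')
  refine le_trans ?_ (le_ciSup hb q)
  simp [hq]

theorem log_max_one (k : ℕ) : Real.log ((max 1 k : ℕ) : ℝ) = Real.log (k : ℝ) := by
  rcases Nat.eq_zero_or_pos k with rfl | h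
  · simp
  · rw [max_eq_right h]

theorem log_rel_le {Ω W : Type*} {R Q : Set (Set (Ω × W))} {ω : Ω} {k : ℕ}
    (h : RelCovBy R Q ω k) : Real.log (relCoverNum R Q ω : ℝ) ≤ Real.log (k : ℝ) := by
  rw [← log_max_one k, ← log_max_one (relCoverNum R Q ω)]
  refine Real.log_le_log (by positivity) ?_
  exact_mod_cast max_le (le_max_left _ _) (relCoverNum_le h)

theorem log_mul_max (a b : ℕ) : Real.log ((max 1 a * max 1 b : ℕ) : ℝ)
    = Real.log (a : ℝ) + Real.log (b : ℝ) := by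
  rw [Nat.cast_mul, Real.log_mul (by positivity) (by positivity), log_max_one, log_max_one]

theorem RelCovBy.mono {Ω W : Type*} {R Q : Set (Set (Ω × W))} {ω : Ω} {k l : ℕ}
    (h : RelCovBy R Q ω k) (hkl : k ≤ l) : RelCovBy R Q ω l := fun q hq => (h q hq).mono hkl

/-- Chain rule. -/
theorem RelCovBy.chain {Ω W : Type*} {R R' Q Q' : Set (Set (Ω × W))} {ω : Ω} {k l : ℕ}
    (h1 : RelCovBy R' Q ω k) (h2 : RelCovBy R Q' ω l)
    (hQ' : ∀ r ∈ R', ∀ q ∈ Q, r ∩ q ∈ Q') : RelCovBy R Q ω (k * l) := by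
  classical
  intro q hq
  obtain ⟨F, hF1, hF2, hF3⟩ := h1 q hq
  have : ∀ r ∈ F, ∃ G : Finset (Set (Ω × W)), ↑G ⊆ R ∧ G.card ≤ l ∧
      ∀ x, (ω, x) ∈ r ∩ q → ∃ u ∈ G, (ω, x) ∈ u := fun r hr => h2 _ (hQ' r (hF1 hr) q hq)
  choose! G hG1 hG2 hG3 using this
  refine ⟨F.biUnion G, ?_, ?_, ?_⟩
  · intro u hu
    simp only [Finset.coe_biUnion, mem_iUnion] at hu
    obtain ⟨r, hr, hu⟩ := hu
    exact hG1 r hr hu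
  · refine (Finset.card_biUnion_le_card_mul F G l hG2).trans ?_
    exact Nat.mul_le_mul_right l hF2
  · intro x hx
    obtain ⟨r, hr, hxr⟩ := hF3 x hx
    obtain ⟨u, hu, hxu⟩ := hG3 r hr x ⟨hxr, hx⟩
    exact ⟨u, Finset.mem_biUnion.2 ⟨r, hr, hu⟩, hxu⟩

theorem iterJoin_one {Z : Type*} (Γ : Z → Z) (Q : Set (Set Z)) : iterJoin Γ Q 1 = Q := by
  ext s
  constructor
  · rintro ⟨f, hf, rfl⟩
    simpa using hf 0
  · intro hs
    exact ⟨fun _ => s, fun _ => hs, by simp⟩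

theorem mem_iterJoin_inter {Z : Type*} (Γ : Z → Z) (n : ℕ) (f : ℕ → Set Z) (z : Z) :
    z ∈ (⋂ i ∈ Finset.range n, (Γ^[i]) ⁻¹' (f i)) ↔ ∀ i < n, Γ^[i] z ∈ f i := by
  simp

theorem iterJoin_add {Z : Type*} (Γ : Z → Z) (Q : Set (Set Z)) (a b : ℕ) :
    iterJoin Γ Q (a + b) = image2 (fun u v => u ∩ (Γ^[a]) ⁻¹' v) (iterJoin Γ Q a)
      (iterJoin Γ Q b) := by
  ext s
  constructor
  · rintro ⟨f, hf, rfl⟩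
    refine ⟨_, ⟨f, hf, rfl⟩, _, ⟨fun i => f (a + i), fun i => hf _, rfl⟩, ?_⟩
    ext z
    simp only [mem_inter_iff, mem_preimage, mem_iterJoin_inter]
    constructor
    · rintro ⟨h1, h2⟩ i hi
      by_cases h : i < a
      · exact h1 i h
      · have := h2 (i - a) (by omega)
        rw [← Function.iterate_add_apply] at this
        rwa [show i - a + a = i by omega, show a + (i - a) = i by omega] at this
    · intro h
      refine ⟨fun i hi => h i (by omega), fun i hi => ?_⟩
      rw [← Function.iterate_add_apply, add_comm i a]
      exact h (a + i) (by omega)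
  · rintro ⟨_, ⟨f, hf, rfl⟩, _, ⟨g, hg, rfl⟩, rfl⟩
    refine ⟨fun i => if i < a then f i else g (i - a), fun i => ?_, ?_⟩
    · dsimp only; split_ifs
      · exact hf i
      · exact hg _
    · ext z
      simp only [mem_inter_iff, mem_preimage, mem_iterJoin_inter]
      constructor
      · rintro ⟨h1, h2⟩ i hi
        by_cases h : i < a
        · rw [if_pos h]; exact h1 i h
        · rw [if_neg h]
          have := h2 (i - a) (by omega)
          rw [← Function.iterate_add_apply] at this
          rwa [show i - a + a = i by omega] at this
      · intro h
        refine ⟨fun i hi => ?_, fun i hi => ?_⟩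
        · have := h i (by omega)
          rwa [if_pos hi] at this
        · rw [← Function.iterate_add_apply, add_comm i a]
          have := h (a + i) (by omega)
          rwa [if_neg (by omega), show a + i - a = i by omega] at this

theorem iterJoin_zero {Z : Type*} (Γ Γ' : Z → Z) (Q Q' : Set (Set Z))
    (h : Q.Nonempty ↔ Q'.Nonempty) : iterJoin Γ Q 0 = iterJoin Γ' Q' 0 := by
  ext s
  constructor
  · rintro ⟨f, hf, rfl⟩
    obtain ⟨q, hq⟩ := h.1 ⟨_, hf 0⟩
    exact ⟨fun _ => q, fun _ => hq, by simp⟩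
  · rintro ⟨f, hf, rfl⟩
    obtain ⟨q, hq⟩ := h.2 ⟨_, hf 0⟩
    exact ⟨fun _ => q, fun _ => hq, by simp⟩

theorem iterJoin_nonempty {Z : Type*} (Γ : Z → Z) (Q : Set (Set Z)) (n : ℕ) :
    (iterJoin Γ Q n).Nonempty ↔ Q.Nonempty := by
  constructor
  · rintro ⟨_, f, hf, rfl⟩
    exact ⟨_, hf 0⟩
  · rintro ⟨q, hq⟩
    exact ⟨_, fun _ => q, fun _ => hq, rfl⟩

theorem iterJoin_mul {Z : Type*} (Γ : Z → Z) (Q : Set (Set Z)) (m n : ℕ) :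
    iterJoin (Γ^[m]) (iterJoin Γ Q m) n = iterJoin Γ Q (m * n) := by
  induction n with
  | zero => exact iterJoin_zero _ _ _ _ (iterJoin_nonempty _ _ _)
  | succ n ih =>
    rw [iterJoin_add, iterJoin_one, ih, Nat.mul_succ, iterJoin_add, ← Function.iterate_mul]

theorem iterJoin_refine {Z : Type*} (Γ : Z → Z) (R R' : Set (Set Z)) (n : ℕ)
    (hR : ∀ u ∈ R, ∃ u' ∈ R', u ⊆ u') :
    ∀ u ∈ iterJoin Γ R n, ∃ u' ∈ iterJoin Γ R' n, u ⊆ u' := by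
  choose! g hg1 hg2 using hR
  rintro _ ⟨f, hf, rfl⟩
  refine ⟨_, ⟨fun i => g (f i), fun i => hg1 _ (hf i), rfl⟩, ?_⟩
  intro z
  simp only [mem_iterJoin_inter]
  exact fun h i hi => hg2 _ (hf i) (h i hi)

theorem iterJoin_refine_self {Z : Type*} (Γ : Z → Z) (R : Set (Set Z)) (n : ℕ) (hn : 1 ≤ n) :
    ∀ u ∈ iterJoin Γ R n, ∃ u' ∈ R, u ⊆ u' := by
  rintro _ ⟨f, hf, rfl⟩
  refine ⟨f 0, hf 0, ?_⟩
  intro z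
  simp only [mem_iterJoin_inter]
  exact fun h => h 0 (by omega)

theorem iterJoin_countable {Z : Type*} (Γ : Z → Z) (Q : Set (Set Z)) (n : ℕ)
    (hQ : Q.Countable) : (iterJoin Γ Q n).Countable := by
  induction n with
  | zero =>
    refine (countable_singleton (univ : Set Z)).mono ?_
    rintro _ ⟨f, hf, rfl⟩
    simp
  | succ n ih =>
    rw [iterJoin_add, iterJoin_one]
    exact ih.image2 hQ _

theorem iterJoin_measurable {Z : Type*} [MeasurableSpace Z] (Γ : Z → Z) (hΓ : Measurable Γ)
    (Q : Set (Set Z)) (n : ℕ) (hQ : ∀ q ∈ Q, MeasurableSet q) :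
    ∀ q ∈ iterJoin Γ Q n, MeasurableSet q := by
  rintro _ ⟨f, hf, rfl⟩
  exact Finset.measurableSet_biInter _ fun i _ => (hΓ.iterate i) (hQ _ (hf i))

theorem iterJoin_subset {Z : Type*} (Γ : Z → Z) (Q : Set (Set Z)) (E : Set Z) (n : ℕ) (hn : 1 ≤ n)
    (hQ : ∀ q ∈ Q, q ⊆ E) : ∀ q ∈ iterJoin Γ Q n, q ⊆ E := by
  intro q hq
  obtain ⟨q', h1, h2⟩ := iterJoin_refine_self Γ Q n hn q hq
  exact h2.trans (hQ q' h1)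

theorem iterate_fst {Ω W : Type*} {Θ : Ω × W → Ω × W} {θ : Ω → Ω}
    (h : ∀ p, (Θ p).1 = θ p.1) (n : ℕ) (p : Ω × W) : (Θ^[n] p).1 = θ^[n] p.1 := by
  induction n with
  | zero => rfl
  | succ n ih => rw [Function.iterate_succ_apply', Function.iterate_succ_apply', h, ih]

theorem CovBy.join {Ω W : Type*} {Θ : Ω × W → Ω × W} {θ : Ω → Ω} (h : ∀ p, (Θ p).1 = θ p.1)
    {a b : ℕ} {R : Set (Set (Ω × W))} {q1 q2 : Set (Ω × W)} {ω : Ω} {k l : ℕ}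
    (h1 : CovBy q1 (iterJoin Θ R a) ω k) (h2 : CovBy q2 (iterJoin Θ R b) (θ^[a] ω) l) :
    CovBy (q1 ∩ (Θ^[a]) ⁻¹' q2) (iterJoin Θ R (a + b)) ω (k * l) := by
  classical
  obtain ⟨F, hF1, hF2, hF3⟩ := h1
  obtain ⟨G, hG1, hG2, hG3⟩ := h2
  refine ⟨Finset.image₂ (fun u v => u ∩ (Θ^[a]) ⁻¹' v) F G, ?_, ?_, ?_⟩
  · rw [iterJoin_add, Finset.coe_image₂]
    exact image2_subset hF1 hG1
  · exact (Finset.card_image₂_le _ _ _).trans (Nat.mul_le_mul hF2 hG2)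
  · rintro x ⟨hx1, hx2⟩
    obtain ⟨u, hu, hxu⟩ := hF3 x hx1
    have e : Θ^[a] (ω, x) = (θ^[a] ω, (Θ^[a] (ω, x)).2) :=
      Prod.ext (iterate_fst h a (ω, x)) rfl
    rw [mem_preimage, e] at hx2
    obtain ⟨v, hv, hxv⟩ := hG3 _ hx2
    refine ⟨_, Finset.mem_image₂_of_mem hu hv, hxu, ?_⟩
    rw [mem_preimage, e]; exact hxv

theorem RelCovBy.join {Ω W : Type*} {Θ : Ω × W → Ω × W} {θ : Ω → Ω} (h : ∀ p, (Θ p).1 = θ p.1)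
    {a b : ℕ} {R Q : Set (Set (Ω × W))} {ω : Ω} {k l : ℕ}
    (h1 : RelCovBy (iterJoin Θ R a) (iterJoin Θ Q a) ω k)
    (h2 : RelCovBy (iterJoin Θ R b) (iterJoin Θ Q b) (θ^[a] ω) l) :
    RelCovBy (iterJoin Θ R (a + b)) (iterJoin Θ Q (a + b)) ω (k * l) := by
  intro q hq
  rw [iterJoin_add] at hq
  obtain ⟨q1, hq1, q2, hq2, rfl⟩ := hq
  exact CovBy.join h (h1 q1 hq1) (h2 q2 hq2)

/-- `E` is finitely covered by `R` along the orbit of `ω`. -/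
def Good {Ω W : Type*} (E : Set (Ω × W)) (θ : Ω → Ω) (R : Set (Set (Ω × W))) (ω : Ω) : Prop :=
  ∀ i, ∃ k, CovBy E R (θ^[i] ω) k

theorem Good.iterate {Ω W : Type*} {E : Set (Ω × W)} {θ : Ω → Ω} {R : Set (Set (Ω × W))} {ω : Ω}
    (h : Good E θ R ω) (n : ℕ) : Good E θ R (θ^[n] ω) := by
  intro i
  rw [← Function.iterate_add_apply]
  exact h _

theorem Good.covBy {Ω W : Type*} {E : Set (Ω × W)} {Θ : Ω × W → Ω × W} {θ : Ω → Ω}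
    (h : ∀ p, (Θ p).1 = θ p.1) (hE : MapsTo Θ E E) {R : Set (Set (Ω × W))} {ω : Ω}
    (hG : Good E θ R ω) (n : ℕ) : ∃ k, CovBy E (iterJoin Θ R (n + 1)) ω k := by
  induction n with
  | zero => rw [zero_add, iterJoin_one]; exact hG 0
  | succ n ih =>
    obtain ⟨k, hk⟩ := ih
    obtain ⟨l, hl⟩ := hG (n + 1)
    rw [← iterJoin_one Θ R] at hl
    refine ⟨_, (CovBy.join h hk hl).mono_left ?_⟩
    exact fun p hp => ⟨hp, hE.iterate (n + 1) hp⟩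

theorem Good.relCovBy {Ω W : Type*} {E : Set (Ω × W)} {Θ : Ω × W → Ω × W} {θ : Ω → Ω}
    (h : ∀ p, (Θ p).1 = θ p.1) (hE : MapsTo Θ E E) {R Q : Set (Set (Ω × W))} {ω : Ω}
    (hG : Good E θ R ω) (hQ : ∀ q ∈ Q, q ⊆ E) {n : ℕ} (hn : 1 ≤ n) :
    RelCovBy (iterJoin Θ R n) (iterJoin Θ Q n) ω
      (relCoverNum (iterJoin Θ R n) (iterJoin Θ Q n) ω) := by
  obtain ⟨n, rfl⟩ := Nat.exists_eq_add_of_le' hn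
  obtain ⟨k, hk⟩ := hG.covBy h hE n
  exact relCovBy_relCoverNum (k := k)
    fun q hq => hk.mono_left (iterJoin_subset Θ Q E (n + 1) hn hQ q hq)

theorem iterCoverLog_nonneg {Ω W : Type*} (Θ : Ω × W → Ω × W) (R Q : Set (Set (Ω × W))) (n : ℕ)
    (ω : Ω) : 0 ≤ iterCoverLog Θ R Q n ω := Real.log_natCast_nonneg _

theorem iterCoverLog_add {Ω W : Type*} {E : Set (Ω × W)} {Θ : Ω × W → Ω × W} {θ : Ω → Ω}
    (h : ∀ p, (Θ p).1 = θ p.1) (hE : MapsTo Θ E E) {R Q : Set (Set (Ω × W))} {ω : Ω}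
    (hG : Good E θ R ω) (hQ : ∀ q ∈ Q, q ⊆ E) {a b : ℕ} (ha : 1 ≤ a) (hb : 1 ≤ b) :
    iterCoverLog Θ R Q (a + b) ω ≤ iterCoverLog Θ R Q a ω + iterCoverLog Θ R Q b (θ^[a] ω) := by
  unfold iterCoverLog
  rw [← log_mul_max]
  apply log_rel_le
  exact RelCovBy.join h ((hG.relCovBy h hE hQ ha).mono (le_max_right _ _))
    (((hG.iterate a).relCovBy h hE hQ hb).mono (le_max_right _ _))

theorem iterCoverLog_chain {Ω W : Type*} {E : Set (Ω × W)} {Θ : Ω × W → Ω × W} {θ : Ω → Ω}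
    (h : ∀ p, (Θ p).1 = θ p.1) (hE : MapsTo Θ E E) {R R' Q : Set (Set (Ω × W))} {ω : Ω}
    (hG : Good E θ R ω) (hG' : Good E θ R' ω) (hQ : ∀ q ∈ Q, q ⊆ E) {n : ℕ} (hn : 1 ≤ n) :
    iterCoverLog Θ R Q n ω ≤ iterCoverLog Θ R' Q n ω
      + iterCoverLog Θ R (image2 (· ∩ ·) R' Q) n ω := by
  have hQ' : ∀ q ∈ image2 (· ∩ ·) R' Q, q ⊆ E := by
    rintro _ ⟨r, hr, q, hq, rfl⟩
    exact inter_subset_right.trans (hQ q hq)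
  unfold iterCoverLog
  rw [← log_mul_max]
  apply log_rel_le
  refine RelCovBy.chain ((hG'.relCovBy h hE hQ hn).mono (le_max_right _ _))
    ((hG.relCovBy h hE hQ' hn).mono (le_max_right _ _)) ?_
  rintro _ ⟨f, hf, rfl⟩ _ ⟨g, hg, rfl⟩
  refine ⟨fun i => f i ∩ g i, fun i => mem_image2_of_mem (hf i) (hg i), ?_⟩
  ext z
  simp only [mem_inter_iff, mem_iterJoin_inter]
  exact ⟨fun ⟨h1, h2⟩ i hi => ⟨h1 i hi, h2 i hi⟩, fun h => ⟨fun i hi => (h i hi).1,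
    fun i hi => (h i hi).2⟩⟩

theorem iterCoverLog_refineQ {Ω W : Type*} {E : Set (Ω × W)} {Θ : Ω × W → Ω × W} {θ : Ω → Ω}
    (h : ∀ p, (Θ p).1 = θ p.1) (hE : MapsTo Θ E E) {R Q Q' : Set (Set (Ω × W))} {ω : Ω}
    (hG : Good E θ R ω) (hQ : ∀ q ∈ Q, q ⊆ E) (hQQ : ∀ q' ∈ Q', ∃ q ∈ Q, q' ⊆ q)
    {n : ℕ} (hn : 1 ≤ n) :
    iterCoverLog Θ R Q' n ω ≤ iterCoverLog Θ R Q n ω := by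
  unfold iterCoverLog
  apply log_rel_le
  intro q' hq'
  obtain ⟨q, hq, hqq⟩ := iterJoin_refine Θ Q' Q n hQQ q' hq'
  exact ((hG.relCovBy h hE hQ hn) q hq).mono_left hqq

theorem fekete_semigroup (S : ℕ → Prop) (a : ℕ → ℝ) (h0 : ∀ n, 0 ≤ a n) (hS : ∀ n, ¬ S n → a n = 0)
    (hadd : ∀ i j, 1 ≤ i → 1 ≤ j → S i → S j → S (i + j) ∧ a (i + j) ≤ a i + a j)
    (M : ℕ) (hM : 1 ≤ M) (hSM : S M) :
    atTop.limsup (fun n : ℕ => ENNReal.ofReal (a n / n)) ≤ ENNReal.ofReal (a M / M) := by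
  classical
  have hMp : (0 : ℝ) < M := by exact_mod_cast hM
  have hstep : ∀ n0, 1 ≤ n0 → S n0 → ∀ j, S (n0 + M * j) ∧ a (n0 + M * j) ≤ a n0 + j * a M := by
    intro n0 h1 hs j
    induction j with
    | zero => simpa using hs
    | succ j ih =>
      have := hadd (n0 + M * j) M (by omega) hM ih.1 hSM
      rw [Nat.mul_succ, ← add_assoc]
      refine ⟨this.1, this.2.trans ?_⟩
      push_cast
      linarith [ih.2]
  have hres : ∀ r, ∃ C : ℝ, 0 ≤ C ∧ ∀ n, 1 ≤ n → n % M = r → a n ≤ C + n * (a M / M) := by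
    intro r
    by_cases hex : ∃ n0, 1 ≤ n0 ∧ S n0 ∧ n0 % M = r
    · refine ⟨a (Nat.find hex), h0 _, fun n hn hr => ?_⟩
      obtain ⟨e1, e2, e3⟩ := Nat.find_spec hex
      by_cases hs : S n
      · have hle : Nat.find hex ≤ n := Nat.find_min' hex ⟨hn, hs, hr⟩
        obtain ⟨j, hj⟩ : ∃ j, n = Nat.find hex + M * j := by
          have hd : M ∣ n - Nat.find hex := (Nat.modEq_iff_dvd' hle).1 (by
            rw [Nat.ModEq, e3, hr])
          obtain ⟨j, hj⟩ := hd
          exact ⟨j, by omega⟩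
        have h2 := (hstep _ e1 e2 j).2
        rw [← hj] at h2
        refine h2.trans ?_
        have h3 : (M : ℝ) * j ≤ n := by
          have : M * j ≤ n := by omega
          exact_mod_cast this
        have h4 : (j : ℝ) * a M = (M * j) * (a M / M) := by field_simp
        rw [h4]
        have : (M : ℝ) * j * (a M / M) ≤ n * (a M / M) :=
          mul_le_mul_of_nonneg_right h3 (div_nonneg (h0 _) hMp.le)
        linarith
      · rw [hS n hs]
        have := h0 (Nat.find hex)
        have := h0 M
        positivity
    · refine ⟨0, le_rfl, fun n hn hr => ?_⟩
      rw [hS n (fun hs => hex ⟨n, hn, hs, hr⟩)]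
      have := h0 M
      positivity
  choose C hC0 hC using hres
  set D : ℝ := ∑ r ∈ Finset.range M, C r with hD
  have hbound : ∀ n, 1 ≤ n → a n / n ≤ D / n + a M / M := by
    intro n hn
    have hnp : (0 : ℝ) < n := by exact_mod_cast hn
    have h1 := hC (n % M) n hn rfl
    have h2 : C (n % M) ≤ D := Finset.single_le_sum (f := C) (fun i _ => hC0 i)
      (Finset.mem_range.2 (Nat.mod_lt _ hM))
    rw [div_add' _ _ _ hnp.ne', div_le_div_iff_of_pos_right hnp]
    linarith
  have ht : Tendsto (fun n : ℕ => ENNReal.ofReal (D / n + a M / M)) atTop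
      (𝓝 (ENNReal.ofReal (a M / M))) := by
    refine ENNReal.tendsto_ofReal ?_
    have := (tendsto_const_div_atTop_nhds_zero_nat D).add_const (a M / M)
    simpa using this
  rw [← ht.limsup_eq]
  refine limsup_le_limsup ?_
  filter_upwards [eventually_ge_atTop 1] with n hn
  exact ENNReal.ofReal_le_ofReal (hbound n hn)

/-- Abstract skew-product hypotheses. -/
structure Sys {Ω W : Type*} [MeasurableSpace Ω] [MeasurableSpace W] (P : Measure Ω)
    (E : Set (Ω × W)) (Θ : Ω × W → Ω × W) (θ : Ω → Ω) : Prop where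
  fst : ∀ p, (Θ p).1 = θ p.1
  maps : MapsTo Θ E E
  meas : Measurable Θ
  mp : MeasurePreserving θ P P

section
variable {Ω X : Type*} [MeasurableSpace Ω] [MeasurableSpace.CountablyGenerated Ω]
    [MetricSpace X] [CompactSpace X] [MeasurableSpace X] [BorelSpace X]
    {P : Measure Ω} [IsProbabilityMeasure P] [P.IsComplete]

theorem measurableSet_covBy (P : Measure Ω) [IsProbabilityMeasure P] [P.IsComplete]
    {R : Set (Set (Ω × X))} (hR : R.Countable) (hRm : ∀ u ∈ R, MeasurableSet u)
    {q : Set (Ω × X)} (hq : MeasurableSet q) (k : ℕ) : MeasurableSet {ω | CovBy q R ω k} := by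
  have hset : {ω | CovBy q R ω k} =
      ⋃ F ∈ {F : Finset (Set (Ω × X)) | ↑F ⊆ R ∧ F.card ≤ k},
        (Prod.fst '' (q \ ⋃ u ∈ F, u))ᶜ := by
    ext ω
    simp only [mem_setOf_eq, mem_iUnion, CovBy]
    constructor
    · rintro ⟨F, h1, h2, h3⟩
      refine ⟨F, ⟨h1, h2⟩, ?_⟩
      rintro ⟨⟨ω', x⟩, ⟨hx, hx'⟩, rfl⟩
      obtain ⟨u, hu, hxu⟩ := h3 x hx
      exact hx' (mem_biUnion (by exact hu) hxu)
    · rintro ⟨F, ⟨h1, h2⟩, h3⟩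
      refine ⟨F, h1, h2, fun x hx => ?_⟩
      by_contra hcon
      refine h3 ⟨(ω, x), ⟨hx, ?_⟩, rfl⟩
      simp only [mem_iUnion]
      rintro ⟨u, hu, hxu⟩
      exact hcon ⟨u, hu, hxu⟩
  rw [hset]
  refine MeasurableSet.biUnion ?_ fun F hF => ?_
  · have h1 := Set.countable_setOf_finite_subset hR
    have h2 : InjOn (fun F : Finset (Set (Ω × X)) => (F : Set (Set (Ω × X))))
      {F | ↑F ⊆ R ∧ F.card ≤ k} := fun F _ G _ h => Finset.coe_injective h
    refine MapsTo.countable_of_injOn (t := {t | t.Finite ∧ t ⊆ R}) ?_ h2 h1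
    intro F hF
    exact ⟨F.finite_toSet, hF.1⟩
  · refine (proj_measurable P _ (hq.diff ?_)).compl
    exact Finset.measurableSet_biUnion _ fun u hu => hRm u (hF.1 hu)

theorem aemeasurable_log {E : Set (Ω × X)} {Θ : Ω × X → Ω × X} {θ : Ω → Ω} (hs : Sys P E Θ θ)
    {R Q : Set (Set (Ω × X))} (hR : R.Countable) (hRm : ∀ u ∈ R, MeasurableSet u)
    (hQ : Q.Countable) (hQm : ∀ u ∈ Q, MeasurableSet u) (hQE : ∀ q ∈ Q, q ⊆ E)
    (hG : ∀ᵐ ω ∂P, Good E θ R ω) {n : ℕ} (hn : 1 ≤ n) :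
    Measurable (iterCoverLog Θ R Q n) := by
  have hmeas : Measurable fun ω =>
      max 1 (relCoverNum (iterJoin Θ R n) (iterJoin Θ Q n) ω) := by
    refine measurable_of_Iic fun k => ?_
    rcases Nat.eq_zero_or_pos k with rfl | hk
    · convert MeasurableSet.empty (α := Ω)
      ext ω; simp
    have hD : MeasurableSet {ω | RelCovBy (iterJoin Θ R n) (iterJoin Θ Q n) ω k} := by
      have : {ω | RelCovBy (iterJoin Θ R n) (iterJoin Θ Q n) ω k} =
          ⋂ q ∈ iterJoin Θ Q n, {ω | CovBy q (iterJoin Θ R n) ω k} := by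
        ext ω; simp [RelCovBy]
      rw [this]
      exact MeasurableSet.biInter (iterJoin_countable Θ Q n hQ) fun q hq =>
        measurableSet_covBy P (iterJoin_countable Θ R n hR)
          (iterJoin_measurable Θ hs.meas R n hRm) (iterJoin_measurable Θ hs.meas Q n hQm q hq) k
    refine NullMeasurableSet.measurable_of_complete (μ := P) (hD.nullMeasurableSet.congr ?_)
    rw [Filter.eventuallyEq_set]
    filter_upwards [hG] with ω hω
    have hrel := hω.relCovBy hs.fst hs.maps hQE hn
    constructor
    · intro h
      have := relCoverNum_le h
      simp only [mem_preimage, mem_Iic]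
      omega
    · intro h
      simp only [mem_preimage, mem_Iic] at h
      exact hrel.mono (by omega)
  have : iterCoverLog Θ R Q n = (fun j : ℕ => Real.log (j : ℝ)) ∘ fun ω =>
      max 1 (relCoverNum (iterJoin Θ R n) (iterJoin Θ Q n) ω) := by
    ext ω
    simp only [iterCoverLog, Function.comp]
    rw [log_max_one]
  rw [this]
  exact (measurable_from_nat).comp hmeas

theorem int_add {E : Set (Ω × X)} {Θ : Ω × X → Ω × X} {θ : Ω → Ω} (hs : Sys P E Θ θ)
    {R Q : Set (Set (Ω × X))} (hR : R.Countable) (hRm : ∀ u ∈ R, MeasurableSet u)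
    (hQ : Q.Countable) (hQm : ∀ u ∈ Q, MeasurableSet u) (hQE : ∀ q ∈ Q, q ⊆ E)
    (hG : ∀ᵐ ω ∂P, Good E θ R ω) (a b : ℕ) (ha : 1 ≤ a) (hb : 1 ≤ b)
    (hia : Integrable (iterCoverLog Θ R Q a) P) (hib : Integrable (iterCoverLog Θ R Q b) P) :
    Integrable (iterCoverLog Θ R Q (a + b)) P ∧
      ∫ ω, iterCoverLog Θ R Q (a + b) ω ∂P ≤
        ∫ ω, iterCoverLog Θ R Q a ω ∂P + ∫ ω, iterCoverLog Θ R Q b ω ∂P := by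
  have hmp := hs.mp.iterate a
  have hib' : Integrable (fun ω => iterCoverLog Θ R Q b (θ^[a] ω)) P :=
    hmp.integrable_comp_of_integrable hib
  have hle : ∀ᵐ ω ∂P, iterCoverLog Θ R Q (a + b) ω ≤
      iterCoverLog Θ R Q a ω + iterCoverLog Θ R Q b (θ^[a] ω) := by
    filter_upwards [hG] with ω hω
    exact iterCoverLog_add hs.fst hs.maps hω hQE ha hb
  have hint : Integrable (iterCoverLog Θ R Q (a + b)) P := by
    refine (hia.add hib').mono'
      (aemeasurable_log hs hR hRm hQ hQm hQE hG (by omega)).aestronglyMeasurable ?_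
    filter_upwards [hle] with ω hω
    rw [Real.norm_of_nonneg (iterCoverLog_nonneg _ _ _ _ _)]
    exact hω
  refine ⟨hint, ?_⟩
  have h1 := integral_mono_ae hint (hia.add hib') hle
  have h2 : ∫ ω, iterCoverLog Θ R Q b (θ^[a] ω) ∂P = ∫ ω, iterCoverLog Θ R Q b ω ∂P := by
    have hm := aemeasurable_log hs hR hRm hQ hQm hQE hG hb
    have h3 := integral_map (μ := P) hmp.measurable.aemeasurable
      (f := iterCoverLog Θ R Q b) (hm.aestronglyMeasurable)
    rw [hmp.map_eq] at h3
    exact h3.symm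
  rw [← h2, ← integral_add hia hib']
  exact h1

theorem relCoverEnt_le {E : Set (Ω × X)} {Θ : Ω × X → Ω × X} {θ : Ω → Ω} (hs : Sys P E Θ θ)
    {R Q : Set (Set (Ω × X))} (hR : R.Countable) (hRm : ∀ u ∈ R, MeasurableSet u)
    (hQ : Q.Countable) (hQm : ∀ u ∈ Q, MeasurableSet u) (hQE : ∀ q ∈ Q, q ⊆ E)
    (hG : ∀ᵐ ω ∂P, Good E θ R ω) (M : ℕ) (hM : 1 ≤ M)
    (hi : Integrable (iterCoverLog Θ R Q M) P) :
    relCoverEnt P Θ R Q ≤ ENNReal.ofReal ((∫ ω, iterCoverLog Θ R Q M ω ∂P) / M) := by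
  refine fekete_semigroup (fun n => Integrable (iterCoverLog Θ R Q n) P)
    (fun n => ∫ ω, iterCoverLog Θ R Q n ω ∂P)
    (fun n => integral_nonneg fun ω => iterCoverLog_nonneg _ _ _ _ _)
    (fun n hn => integral_undef hn) ?_ M hM hi
  intro i j hi hj h1 h2
  exact int_add hs hR hRm hQ hQm hQE hG i j hi hj h1 h2

theorem int_mul {E : Set (Ω × X)} {Θ : Ω × X → Ω × X} {θ : Ω → Ω} (hs : Sys P E Θ θ)
    {R Q : Set (Set (Ω × X))} (hR : R.Countable) (hRm : ∀ u ∈ R, MeasurableSet u)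
    (hQ : Q.Countable) (hQm : ∀ u ∈ Q, MeasurableSet u) (hQE : ∀ q ∈ Q, q ⊆ E)
    (hG : ∀ᵐ ω ∂P, Good E θ R ω) (M : ℕ) (hM : 1 ≤ M)
    (hi : Integrable (iterCoverLog Θ R Q M) P) (j : ℕ) :
    Integrable (iterCoverLog Θ R Q (M * (j + 1))) P ∧
      ∫ ω, iterCoverLog Θ R Q (M * (j + 1)) ω ∂P ≤
        (j + 1 : ℕ) * ∫ ω, iterCoverLog Θ R Q M ω ∂P := by
  induction j with
  | zero => simpa using hi
  | succ j ih =>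
    have h1 : 1 ≤ M * (j + 1) := Nat.mul_pos hM (Nat.succ_pos j)
    have := int_add hs hR hRm hQ hQm hQE hG (M * (j + 1)) M h1 hM ih.1 hi
    rw [Nat.mul_succ M (j + 1)]
    refine ⟨this.1, this.2.trans ?_⟩
    have h2 := ih.2
    push_cast at h2 ⊢
    linarith

theorem good_of_finite {E : Set (Ω × X)} {R : Set (Set (Ω × X))} (θ : Ω → Ω)
    (hR : IsRandomCover E R) (hf : R.Finite) (ω : Ω) : Good E θ R ω := by
  intro i
  refine ⟨hf.toFinset.card, hf.toFinset, by simp, le_rfl, fun x hx => ?_⟩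
  have := hR.2.2.2 (θ^[i] ω) hx
  simp only [mem_iUnion] at this
  obtain ⟨u, hu, hxu⟩ := this
  exact ⟨u, by simpa using hu, hxu⟩

theorem good_of_open {E : Set (Ω × X)} (hEc : ∀ ω, IsCompact (fib E ω)) {R : Set (Set (Ω × X))}
    {θ : Ω → Ω} (hmp : MeasurePreserving θ P P)
    (hR : IsOpenRandomCover P E R) : ∀ᵐ ω ∂P, Good E θ R ω := by
  classical
  have h1 : ∀ᵐ ω ∂P, ∃ k, CovBy E R ω k := by
    have : ∀ᵐ ω ∂P, ∀ q ∈ R, ∃ U : Set X, IsOpen U ∧ fib q ω = U ∩ fib E ω :=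
      (ae_ball_iff hR.1.1).2 hR.2
    filter_upwards [this] with ω hω
    choose! U hU1 hU2 using hω
    obtain ⟨t, ht⟩ := (hEc ω).elim_finite_subcover (fun q : R => U q) (fun q => hU1 q q.2) (by
      intro x hx
      have := hR.1.2.2.2 ω hx
      simp only [mem_iUnion] at this
      obtain ⟨u, hu, hxu⟩ := this
      rw [hU2 u hu] at hxu
      exact mem_iUnion.2 ⟨⟨u, hu⟩, hxu.1⟩)
    refine ⟨_, t.image Subtype.val, ?_, le_rfl, fun x hx => ?_⟩
    · intro u hu
      simp only [Finset.coe_image, mem_image] at hu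
      obtain ⟨v, _, rfl⟩ := hu
      exact v.2
    · have := ht hx
      simp only [mem_iUnion] at this
      obtain ⟨u, hu, hxu⟩ := this
      refine ⟨u, Finset.mem_image_of_mem _ hu, ?_⟩
      have h3 : x ∈ fib u ω := by
        rw [hU2 u u.2]; exact ⟨hxu, hx⟩
      exact h3
  unfold Good
  rw [ae_all_iff]
  intro i
  exact (hmp.iterate i).quasiMeasurePreserving.ae h1

theorem integrable_of_finite {E : Set (Ω × X)} {Θ : Ω × X → Ω × X} {θ : Ω → Ω} (hs : Sys P E Θ θ)
    {R Q : Set (Set (Ω × X))} (hR : IsRandomCover E R) (hf : R.Finite) (hQ : IsRandomCover E Q)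
    (n : ℕ) (hn : 1 ≤ n) : Integrable (iterCoverLog Θ R Q n) P := by
  have hG : ∀ᵐ ω ∂P, Good E θ R ω := Eventually.of_forall fun ω => good_of_finite θ hR hf ω
  have h1 : Integrable (iterCoverLog Θ R Q 1) P := by
    refine Integrable.of_bound
      (aemeasurable_log hs hR.1 hR.2.1 hQ.1 hQ.2.1 hQ.2.2.1 hG le_rfl).aestronglyMeasurable
      (Real.log (hf.toFinset.card : ℝ)) (Eventually.of_forall fun ω => ?_)
    rw [Real.norm_of_nonneg (iterCoverLog_nonneg _ _ _ _ _)]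
    refine log_rel_le ?_
    rw [iterJoin_one, iterJoin_one]
    intro q hq
    refine ⟨hf.toFinset, by simp, le_rfl, fun x hx => ?_⟩
    have := hR.2.2.2 ω (hQ.2.2.1 q hq hx)
    simp only [mem_iUnion] at this
    obtain ⟨u, hu, hxu⟩ := this
    exact ⟨u, by simpa using hu, hxu⟩
  obtain ⟨n, rfl⟩ := Nat.exists_eq_add_of_le' hn
  have := (int_mul hs hR.1 hR.2.1 hQ.1 hQ.2.1 hQ.2.2.1 hG 1 le_rfl h1 n).1
  rwa [one_mul] at this

end

section
variable {Ω X : Type*} [MeasurableSpace Ω] [MeasurableSpace.CountablyGenerated Ω]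
    [MetricSpace X] [CompactSpace X] [MeasurableSpace X] [BorelSpace X]
    {P : Measure Ω} [IsProbabilityMeasure P] [P.IsComplete]

theorem exists_trunc {E : Set (Ω × X)} (hE : MeasurableSet E) {R : Set (Set (Ω × X))}
    (hR : IsOpenRandomCover P E R) :
    ∃ (Rk : ℕ → Set (Set (Ω × X))) (A : ℕ → Set Ω),
      (∀ k, IsOpenRandomCover P E (Rk k) ∧ (Rk k).Finite) ∧
      (∀ ω, (∃ j, CovBy E R ω j) → ∀ᶠ k in atTop, ω ∈ A k) ∧
      (∀ k, ∀ u ∈ Rk k, u ∈ R ∨ ∀ ω ∈ A k, ∀ x, (ω, x) ∉ u) := by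
  obtain ⟨g, hg⟩ := Set.countable_iff_exists_injOn.1 hR.1.1
  let F : ℕ → Set (Set (Ω × X)) := fun k => {r | r ∈ R ∧ g r < k}
  have hFR : ∀ k, F k ⊆ R := fun k r hr => hr.1
  have hFf : ∀ k, (F k).Finite := by
    intro k
    refine Set.Finite.of_finite_image ((Set.finite_Iio k).subset ?_) (hg.mono (hFR k))
    rintro _ ⟨r, hr, rfl⟩
    exact hr.2
  let A : ℕ → Set Ω := fun k => (Prod.fst '' (E \ ⋃ u ∈ F k, u))ᶜ
  have hAm : ∀ k, MeasurableSet (A k) := fun k =>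
    (proj_measurable P _ (hE.diff (MeasurableSet.biUnion (hFf k).countable
      fun u hu => hR.1.2.1 u (hFR k hu)))).compl
  have hA : ∀ k ω, ω ∈ A k ↔ ∀ x, (ω, x) ∈ E → ∃ u ∈ F k, (ω, x) ∈ u := by
    intro k ω
    constructor
    · intro h x hx
      by_contra hcon
      refine h ⟨(ω, x), ⟨hx, ?_⟩, rfl⟩
      simp only [mem_iUnion]
      rintro ⟨u, hu, hxu⟩
      exact hcon ⟨u, hu, hxu⟩
    · rintro h ⟨⟨ω', x⟩, ⟨hx, hx'⟩, rfl⟩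
      obtain ⟨u, hu, hxu⟩ := h x hx
      exact hx' (mem_biUnion hu hxu)
  let last : ℕ → Set (Ω × X) := fun k => E ∩ Prod.fst ⁻¹' (A k)ᶜ
  refine ⟨fun k => insert (last k) (F k), A, fun k => ⟨⟨⟨?_, ?_, ?_, ?_⟩, ?_⟩, ?_⟩, ?_, ?_⟩
  · exact ((hFf k).insert _).countable
  · rintro q (rfl | hq)
    · exact hE.inter (measurable_fst (hAm k).compl)
    · exact hR.1.2.1 q (hFR k hq)
  · rintro q (rfl | hq)
    · exact inter_subset_left
    · exact hR.1.2.2.1 q (hFR k hq)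
  · intro ω x hx
    simp only [mem_iUnion]
    by_cases h : ω ∈ A k
    · obtain ⟨u, hu, hxu⟩ := (hA k ω).1 h x hx
      exact ⟨u, Or.inr hu, hxu⟩
    · exact ⟨last k, Or.inl rfl, hx, h⟩
  · rintro q (rfl | hq)
    · refine Eventually.of_forall fun ω => ?_
      by_cases h : ω ∈ A k
      · refine ⟨∅, isOpen_empty, ?_⟩
        rw [empty_inter]
        ext x
        constructor
        · rintro ⟨_, hx⟩
          exact hx h
        · exact fun hx => hx.elim
      · refine ⟨univ, isOpen_univ, ?_⟩
        rw [univ_inter]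
        ext x
        exact ⟨fun hx => hx.1, fun hx => ⟨hx, h⟩⟩
    · exact hR.2 q (hFR k hq)
  · exact (hFf k).insert _
  · rintro ω ⟨j, G, hG1, hG2, hG3⟩
    filter_upwards [eventually_gt_atTop (G.sup g)] with k hk
    rw [hA]
    intro x hx
    obtain ⟨u, hu, hxu⟩ := hG3 x hx
    exact ⟨u, ⟨hG1 hu, lt_of_le_of_lt (Finset.le_sup hu) hk⟩, hxu⟩
  · rintro k u (rfl | hu)
    · exact Or.inr fun ω hω x hx => hx.2 hω
    · exact Or.inl (hFR k hu)

theorem trunc_le {E : Set (Ω × X)} (hE : MeasurableSet E) (hEc : ∀ ω, IsCompact (fib E ω))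
    {Θ : Ω × X → Ω × X} {θ : Ω → Ω} (hs : Sys P E Θ θ)
    {R Q : Set (Set (Ω × X))} (hR : IsOpenRandomCover P E R) (hQ : IsRandomCover E Q) (B : ℝ≥0∞)
    (hB : ∀ R', IsOpenRandomCover P E R' → R'.Finite → relCoverEnt P Θ R' Q ≤ B) :
    relCoverEnt P Θ R Q ≤ B := by
  have hG := good_of_open hEc hs.mp hR
  by_cases hex : ∃ N, 1 ≤ N ∧ Integrable (iterCoverLog Θ R Q N) P
  swap
  · have : relCoverEnt P Θ R Q ≤ 0 := by
      unfold relCoverEnt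
      refine (limsup_le_limsup (v := fun _ => (0 : ℝ≥0∞)) ?_).trans ?_
      · filter_upwards [eventually_ge_atTop 1] with n hn
        rw [integral_undef (fun h => hex ⟨n, hn, h⟩)]
        simp
      · simp
    exact this.trans (zero_le)
  obtain ⟨N, hN, hiN⟩ := hex
  have hNp : (0 : ℝ) < N := by exact_mod_cast hN
  obtain ⟨Rk, A, hRk, hA, hRA⟩ := exists_trunc hE hR
  let Q' : ℕ → Set (Set (Ω × X)) := fun k => image2 (· ∩ ·) (Rk k) Q
  have hQ'c : ∀ k, (Q' k).Countable := fun k => (hRk k).2.countable.image2 hQ.1 _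
  have hQ'm : ∀ k, ∀ q ∈ Q' k, MeasurableSet q := by
    rintro k _ ⟨r, hr, q, hq, rfl⟩
    exact ((hRk k).1.1.2.1 r hr).inter (hQ.2.1 q hq)
  have hQ'Q : ∀ k, ∀ q' ∈ Q' k, ∃ q ∈ Q, q' ⊆ q := by
    rintro k _ ⟨r, hr, q, hq, rfl⟩
    exact ⟨q, hq, inter_subset_right⟩
  have hQ'E : ∀ k, ∀ q ∈ Q' k, q ⊆ E := by
    intro k q' hq'
    obtain ⟨q, hq, h⟩ := hQ'Q k q' hq'
    exact h.trans (hQ.2.2.1 q hq)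
  have hψm : ∀ k n, 1 ≤ n → Measurable (iterCoverLog Θ R (Q' k) n) := fun k n hn =>
    aemeasurable_log hs hR.1.1 hR.1.2.1 (hQ'c k) (hQ'm k) (hQ'E k) hG hn
  have hψle : ∀ k, ∀ᵐ ω ∂P, ‖iterCoverLog Θ R (Q' k) N ω‖ ≤ iterCoverLog Θ R Q N ω := by
    intro k
    filter_upwards [hG] with ω hω
    rw [Real.norm_of_nonneg (iterCoverLog_nonneg _ _ _ _ _)]
    exact iterCoverLog_refineQ hs.fst hs.maps hω hQ.2.2.1 (hQ'Q k) hN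
  have hψi : ∀ k, Integrable (iterCoverLog Θ R (Q' k) N) P := fun k =>
    hiN.mono' (hψm k N hN).aestronglyMeasurable (hψle k)
  let δ : ℕ → ℝ := fun k => ∫ ω, iterCoverLog Θ R (Q' k) N ω ∂P
  have hδ : Tendsto δ atTop (𝓝 0) := by
    have h0 : (0 : ℝ) = ∫ ω, (0 : ℝ) ∂P := by simp
    rw [h0]
    refine tendsto_integral_of_dominated_convergence (iterCoverLog Θ R Q N)
      (fun k => (hψm k N hN).aestronglyMeasurable) hiN hψle ?_
    filter_upwards [hG] with ω hω
    refine tendsto_const_nhds.congr' ?_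
    have hev : ∀ᶠ k in atTop, ∀ i ∈ Finset.range N, θ^[i] ω ∈ A k :=
      (Finset.eventually_all _).2 fun i _ => hA _ (hω i)
    filter_upwards [hev] with k hk
    refine le_antisymm (iterCoverLog_nonneg _ _ _ _ _) ?_
    have h1 : RelCovBy (iterJoin Θ R N) (iterJoin Θ (Q' k) N) ω 1 := by
      rintro _ ⟨f, hf, rfl⟩
      choose r hr q hq hrq using hf
      by_cases hall : ∀ i < N, r i ∈ R
      · refine ⟨{⋂ i ∈ Finset.range N, (Θ^[i]) ⁻¹' (if i < N then r i else r 0)}, ?_, by simp, ?_⟩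
        · simp only [Finset.coe_singleton, singleton_subset_iff]
          refine ⟨_, fun i => ?_, rfl⟩
          split_ifs with h
          · exact hall i h
          · exact hall 0 hN
        · intro x hx
          refine ⟨_, Finset.mem_singleton_self _, ?_⟩
          rw [mem_iterJoin_inter] at hx ⊢
          intro i hi
          rw [if_pos hi]
          have := hx i hi
          rw [← hrq i] at this
          exact this.1
      · push Not at hall
        obtain ⟨i, hi, hri⟩ := hall
        refine ⟨∅, by simp, by simp, fun x hx => ?_⟩
        exfalso
        rw [mem_iterJoin_inter] at hx
        have h2 := hx i hi
        rw [← hrq i] at h2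
        have h3 := ((hRA k (r i) (hr i)).resolve_left hri) (θ^[i] ω) (hk i (Finset.mem_range.2 hi))
        have e : Θ^[i] (ω, x) = (θ^[i] ω, (Θ^[i] (ω, x)).2) :=
          Prod.ext (iterate_fst hs.fst i (ω, x)) rfl
        rw [e] at h2
        exact h3 _ h2.1
    have := log_rel_le h1
    simpa [iterCoverLog] using this
  have hmain : ∀ k, relCoverEnt P Θ R Q ≤ B + ENNReal.ofReal (δ k / N) := by
    intro k
    refine le_trans ?_ (add_le_add_left (hB (Rk k) (hRk k).1 (hRk k).2) _)
    rw [← tsub_le_iff_right]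
    have hall : ∀ j : ℕ, relCoverEnt P Θ R Q - ENNReal.ofReal (δ k / N) ≤
        ENNReal.ofReal ((∫ ω, iterCoverLog Θ (Rk k) Q (N * (j + 1)) ω ∂P) /
          ((N * (j + 1) : ℕ) : ℝ)) := by
      intro j
      have hM : 1 ≤ N * (j + 1) := Nat.mul_pos hN (Nat.succ_pos j)
      have hMp : (0 : ℝ) < ((N * (j + 1) : ℕ) : ℝ) := by exact_mod_cast hM
      rw [tsub_le_iff_right]
      have hi1 := (int_mul hs hR.1.1 hR.1.2.1 hQ.1 hQ.2.1 hQ.2.2.1 hG N hN hiN j).1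
      refine (relCoverEnt_le hs hR.1.1 hR.1.2.1 hQ.1 hQ.2.1 hQ.2.2.1 hG _ hM hi1).trans ?_
      have hi2 := int_mul hs hR.1.1 hR.1.2.1 (hQ'c k) (hQ'm k) (hQ'E k) hG N hN (hψi k) j
      have hi3 := integrable_of_finite hs (hRk k).1.1 (hRk k).2 hQ _ hM
      have hle : ∫ ω, iterCoverLog Θ R Q (N * (j + 1)) ω ∂P ≤
          ∫ ω, iterCoverLog Θ (Rk k) Q (N * (j + 1)) ω ∂P +
            ∫ ω, iterCoverLog Θ R (Q' k) (N * (j + 1)) ω ∂P := by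
        rw [← integral_add hi3 hi2.1]
        refine integral_mono_ae hi1 (hi3.add hi2.1) ?_
        filter_upwards [hG] with ω hω
        exact iterCoverLog_chain hs.fst hs.maps hω
          (good_of_finite θ (hRk k).1.1 (hRk k).2 ω) hQ.2.2.1 hM
      rw [← ENNReal.ofReal_add (div_nonneg (integral_nonneg fun ω =>
        iterCoverLog_nonneg _ _ _ _ _) hMp.le) (div_nonneg (integral_nonneg fun ω =>
        iterCoverLog_nonneg _ _ _ _ _) hNp.le)]
      refine ENNReal.ofReal_le_ofReal ?_
      have e : δ k / N = ((j + 1 : ℕ) * δ k) / ((N * (j + 1) : ℕ) : ℝ) := by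
        push_cast
        have : ((j : ℝ) + 1) ≠ 0 := by positivity
        field_simp
      rw [e, ← add_div, div_le_div_iff_of_pos_right hMp]
      exact hle.trans (add_le_add_right hi2.2 _)
    refine le_limsup_of_frequently_le ?_
    rw [frequently_atTop]
    intro n
    refine ⟨N * (n + 1), ?_, hall n⟩
    exact (Nat.le_succ n).trans (Nat.le_mul_of_pos_left _ hN)
  have hlim : Tendsto (fun k => B + ENNReal.ofReal (δ k / N)) atTop (𝓝 (B + 0)) := by
    refine Tendsto.add tendsto_const_nhds ?_
    have h1 := ENNReal.tendsto_ofReal (hδ.div_const (N : ℝ))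
    simpa using h1
  rw [add_zero] at hlim
  exact ge_of_tendsto' hlim hmain

theorem sys_skew {ϑ : Ω → Ω} {E : Set (Ω × X)} {T : Ω → X → X} (hT : IsBundleRDS P ϑ E T) :
    Sys P E (skew ϑ T) ϑ where
  fst _ := rfl
  maps := fun p hp => hT.mapsTo p.1 hp
  meas := (hT.measurePreserving.measurable.comp measurable_fst).prodMk hT.measurable
  mp := hT.measurePreserving

theorem Sys.pow {E : Set (Ω × X)} {Θ : Ω × X → Ω × X} {θ : Ω → Ω} (hs : Sys P E Θ θ) (m : ℕ) :
    Sys P E (Θ^[m]) (θ^[m]) where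
  fst p := iterate_fst hs.fst m p
  maps := hs.maps.iterate m
  meas := hs.meas.iterate m
  mp := hs.mp.iterate m

theorem randomCover_iterJoin {E : Set (Ω × X)} {Θ : Ω × X → Ω × X} {θ : Ω → Ω}
    (hs : Sys P E Θ θ) {Q : Set (Set (Ω × X))} (hQ : IsRandomCover E Q) (m : ℕ) (hm : 1 ≤ m) :
    IsRandomCover E (iterJoin Θ Q m) := by
  refine ⟨iterJoin_countable Θ Q m hQ.1, iterJoin_measurable Θ hs.meas Q m hQ.2.1,
    iterJoin_subset Θ Q E m hm hQ.2.2.1, fun ω x hx => ?_⟩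
  have : ∀ p ∈ E, ∃ q ∈ Q, p ∈ q := by
    intro p hp
    have := hQ.2.2.2 p.1 (show p.2 ∈ fib E p.1 from hp)
    simp only [mem_iUnion] at this
    obtain ⟨u, hu, hxu⟩ := this
    exact ⟨u, hu, hxu⟩
  have h2 : ∀ i, ∃ q ∈ Q, Θ^[i] (ω, x) ∈ q := fun i => this _ (hs.maps.iterate i hx)
  choose f hf1 hf2 using h2
  simp only [mem_iUnion]
  refine ⟨_, ⟨f, hf1, rfl⟩, ?_⟩
  exact (mem_iterJoin_inter Θ m f (ω, x)).2 fun i _ => hf2 i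

theorem openCover_iterJoin {ϑ : Ω → Ω} {E : Set (Ω × X)} {T : Ω → X → X}
    (hT : IsBundleRDS P ϑ E T) {R : Set (Set (Ω × X))} (hR : IsOpenRandomCover P E R)
    (m : ℕ) (hm : 1 ≤ m) : IsOpenRandomCover P E (iterJoin (skew ϑ T) R m) := by
  have hs := sys_skew hT
  refine ⟨randomCover_iterJoin hs hR.1 m hm, ?_⟩
  have hc : ∀ᵐ ω ∂P, ∀ i, ContinuousOn (T (ϑ^[i] ω)) (fib E (ϑ^[i] ω)) := by
    rw [ae_all_iff]
    intro i
    exact (hs.mp.iterate i).quasiMeasurePreserving.ae hT.continuousOn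
  have ho : ∀ᵐ ω ∂P, ∀ i, ∀ q ∈ R, ∃ U : Set X, IsOpen U ∧
      fib q (ϑ^[i] ω) = U ∩ fib E (ϑ^[i] ω) := by
    rw [ae_all_iff]
    intro i
    exact (hs.mp.iterate i).quasiMeasurePreserving.ae ((ae_ball_iff hR.1.1).2 hR.2)
  obtain ⟨m, rfl⟩ := Nat.exists_eq_add_of_le' hm
  have key : ∀ᵐ ω ∂P, ∀ q ∈ iterJoin (skew ϑ T) R (m + 1),
      ∃ U : Set X, IsOpen U ∧ fib q ω = U ∩ fib E ω := by
    filter_upwards [hc, ho] with ω hcω hoω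
    have hcont : ∀ n, ContinuousOn (fun x => ((skew ϑ T)^[n] (ω, x)).2) (fib E ω) := by
      intro n
      induction n with
      | zero => exact continuousOn_id
      | succ n ih =>
        have e : (fun x => ((skew ϑ T)^[n + 1] (ω, x)).2) =
            T (ϑ^[n] ω) ∘ (fun x => ((skew ϑ T)^[n] (ω, x)).2) := by
          ext x
          rw [Function.iterate_succ_apply']
          simp only [skew, Function.comp]
          have := iterate_fst hs.fst n (ω, x)
          simp only [skew] at this
          rw [this]
        rw [e]
        refine (hcω n).comp ih ?_
        intro x hx
        have h1 : (skew ϑ T)^[n] (ω, x) ∈ E := hs.maps.iterate n hx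
        have e : (skew ϑ T)^[n] (ω, x) = (ϑ^[n] ω, ((skew ϑ T)^[n] (ω, x)).2) :=
          Prod.ext (iterate_fst hs.fst n (ω, x)) rfl
        rw [e] at h1
        exact h1
    clear hm
    induction m with
    | zero => rw [zero_add, iterJoin_one]; exact hoω 0
    | succ n ih =>
      intro q hq
      rw [iterJoin_add, iterJoin_one] at hq
      obtain ⟨u, hu, v, hv, rfl⟩ := hq
      obtain ⟨U, hU, hUu⟩ := ih u hu
      obtain ⟨V, hV, hVv⟩ := hoω (n + 1) v hv
      obtain ⟨V', hV', hVV⟩ := continuousOn_iff'.1 (hcont (n + 1)) V hV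
      refine ⟨U ∩ V', hU.inter hV', ?_⟩
      ext x
      have a1 : (ω, x) ∈ u ↔ x ∈ U ∩ fib E ω := by rw [← hUu]; rfl
      have e : (skew ϑ T)^[n + 1] (ω, x) = (ϑ^[n + 1] ω, ((skew ϑ T)^[n + 1] (ω, x)).2) :=
        Prod.ext (iterate_fst hs.fst (n + 1) (ω, x)) rfl
      have a2 : (skew ϑ T)^[n + 1] (ω, x) ∈ v ↔
          ((skew ϑ T)^[n + 1] (ω, x)).2 ∈ V ∩ fib E (ϑ^[n + 1] ω) := by
        rw [← hVv]
        nth_rewrite 1 [e]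
        rfl
      have a3 : x ∈ fib E ω → ((skew ϑ T)^[n + 1] (ω, x)).2 ∈ fib E (ϑ^[n + 1] ω) := by
        intro hx
        have h1 : (skew ϑ T)^[n + 1] (ω, x) ∈ E := hs.maps.iterate (n + 1) hx
        rw [e] at h1
        exact h1
      have a4 : x ∈ fib E ω → (((skew ϑ T)^[n + 1] (ω, x)).2 ∈ V ↔ x ∈ V') := by
        intro hx
        have := Set.ext_iff.1 hVV x
        simp only [mem_inter_iff, mem_preimage, hx, and_true] at this
        exact this
      change ((ω, x) ∈ u ∧ (skew ϑ T)^[n + 1] (ω, x) ∈ v) ↔ _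
      rw [a1, a2]
      constructor
      · rintro ⟨⟨h1, h2⟩, h3, h4⟩
        exact ⟨⟨h1, (a4 h2).1 h3⟩, h2⟩
      · rintro ⟨⟨h1, h2⟩, h3⟩
        exact ⟨⟨h1, h3⟩, (a4 h3).2 h2, a3 h3⟩
  intro q hq
  filter_upwards [key] with ω hω
  exact hω q hq

theorem pow_zero_case (E : Set (Ω × X)) (Θ : Ω × X → Ω × X) (Q : Set (Set (Ω × X))) :
    condTailEnt P E (Θ^[0]) (iterJoin Θ Q 0) = 0 := by
  unfold condTailEnt
  refine le_antisymm (iSup_le fun R => iSup_le fun _ => ?_) (zero_le)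
  have hlog : ∀ n, 1 ≤ n → iterCoverLog (Θ^[0]) R (iterJoin Θ Q 0) n =
      fun ω => Real.log (relCoverNum R (iterJoin Θ Q 0) ω : ℝ) := by
    intro n hn
    ext ω
    unfold iterCoverLog
    rw [iterJoin_mul, zero_mul]
    congr 2
    unfold relCoverNum
    congr 1
    ext q
    congr 1
    ext hq
    rw [coverNum_eq, coverNum_eq]
    congr 3
    ext k
    constructor
    · intro h
      exact CovBy.refine h (iterJoin_refine_self _ R n hn)
    · intro h
      refine CovBy.refine h fun u hu => ?_
      refine ⟨_, ⟨fun _ => u, fun _ => hu, rfl⟩, ?_⟩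
      intro z hz
      rw [mem_iterJoin_inter]
      intro i _
      rw [← Function.iterate_mul, zero_mul]
      exact hz
  set c := ∫ ω, Real.log (relCoverNum R (iterJoin Θ Q 0) ω : ℝ) ∂P
  have ht : Tendsto (fun n : ℕ => ENNReal.ofReal (c / n)) atTop (𝓝 0) := by
    have := ENNReal.tendsto_ofReal (tendsto_const_div_atTop_nhds_zero_nat c)
    simpa using this
  unfold relCoverEnt
  rw [← ht.limsup_eq]
  refine limsup_le_limsup ?_
  filter_upwards [eventually_ge_atTop 1] with n hn
  rw [hlog n hn]

theorem le_condTailEnt {E : Set (Ω × X)} {Θ : Ω × X → Ω × X} {R Q : Set (Set (Ω × X))}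
    (hR : IsOpenRandomCover P E R) : relCoverEnt P Θ R Q ≤ condTailEnt P E Θ Q := by
  unfold condTailEnt
  exact le_iSup₂_of_le R hR le_rfl

theorem limsup_sub (u : ℕ → ℝ≥0∞) (m : ℕ) (hm : 1 ≤ m) :
    atTop.limsup (fun n => (m : ℝ≥0∞) * u (m * n)) ≤ (m : ℝ≥0∞) * atTop.limsup u := by
  rw [ENNReal.limsup_const_mul_of_ne_top (ENNReal.natCast_ne_top m)]
  refine mul_le_mul_right ?_ _
  have hg : Tendsto (fun n => m * n) atTop atTop := tendsto_id.const_mul_atTop' hm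
  exact Filter.Tendsto.limsup_comp_le_limsup (u := u) hg

theorem real_aux (m n : ℕ) (hm : 1 ≤ m) (a : ℝ) :
    (m : ℝ≥0∞) * ENNReal.ofReal (a / ((m * n : ℕ) : ℝ)) = ENNReal.ofReal (a / n) := by
  have hmp : (0 : ℝ) < m := by exact_mod_cast hm
  rw [← ENNReal.ofReal_natCast m, ← ENNReal.ofReal_mul hmp.le]
  congr 1
  push_cast
  field_simp

theorem int_le_aux {Θ : Ω × X → Ω × X} {θ : Ω → Ω} {E : Set (Ω × X)} (hs : Sys P E Θ θ)
    {R Q : Set (Set (Ω × X))} (hR : IsRandomCover E R) (hf : R.Finite)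
    (hQ : IsRandomCover E Q) (m n : ℕ) (hm : 1 ≤ m) (hmn : 1 ≤ m * n) :
    ∫ ω, iterCoverLog (Θ^[m]) R (iterJoin Θ Q m) n ω ∂P ≤
      ∫ ω, iterCoverLog Θ R Q (m * n) ω ∂P := by
  refine integral_mono_of_nonneg
    (Eventually.of_forall fun ω => iterCoverLog_nonneg _ _ _ _ _)
    (integrable_of_finite hs hR hf hQ _ hmn) (Eventually.of_forall fun ω => ?_)
  unfold iterCoverLog
  refine log_rel_le ?_
  rw [iterJoin_mul]
  intro q hq
  refine CovBy.refine ((good_of_finite θ hR hf ω).relCovBy hs.fst hs.maps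
    hQ.2.2.1 hmn q hq) ?_
  rw [← iterJoin_mul]
  exact iterJoin_refine _ _ _ n (iterJoin_refine_self _ R m hm)

theorem ent_le_aux {Θ : Ω × X → Ω × X} {θ : Ω → Ω} {E : Set (Ω × X)} (hs : Sys P E Θ θ)
    {R Q : Set (Set (Ω × X))} (hR : IsRandomCover E R) (hf : R.Finite)
    (hQ : IsRandomCover E Q) (m : ℕ) (hm : 1 ≤ m) :
    relCoverEnt P (Θ^[m]) R (iterJoin Θ Q m) ≤ (m : ℝ≥0∞) * relCoverEnt P Θ R Q := by
  unfold relCoverEnt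
  refine le_trans (limsup_le_limsup ?_) (limsup_sub _ m hm)
  filter_upwards [eventually_ge_atTop 1] with n hn
  have hmn : 1 ≤ m * n := Nat.mul_pos hm hn
  have hnp : (0 : ℝ) < n := by exact_mod_cast hn
  rw [real_aux m n hm]
  refine ENNReal.ofReal_le_ofReal ?_
  rw [div_le_div_iff_of_pos_right hnp]
  exact int_le_aux hs hR hf hQ m n hm hmn

theorem le_ent_aux {Θ : Ω × X → Ω × X} {θ : Ω → Ω} {E : Set (Ω × X)} (hs : Sys P E Θ θ)
    {R Q : Set (Set (Ω × X))} (hR : IsRandomCover E R) (hf : R.Finite)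
    (hQ : IsRandomCover E Q) (m : ℕ) (hm : 1 ≤ m) :
    (m : ℝ≥0∞) * relCoverEnt P Θ R Q ≤ relCoverEnt P (Θ^[m]) (iterJoin Θ R m) (iterJoin Θ Q m) := by
  have key : ∀ n, 1 ≤ n → (m : ℝ≥0∞) * relCoverEnt P Θ R Q ≤
      ENNReal.ofReal ((∫ ω, iterCoverLog (Θ^[m]) (iterJoin Θ R m) (iterJoin Θ Q m) n ω ∂P) / n) := by
    intro n hn
    have hmn : 1 ≤ m * n := Nat.mul_pos hm hn
    have h2 := relCoverEnt_le hs hR.1 hR.2.1 hQ.1 hQ.2.1 hQ.2.2.1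
      (Eventually.of_forall fun ω => good_of_finite θ hR hf ω) (m * n) hmn
      (integrable_of_finite hs hR hf hQ _ hmn)
    have e : iterCoverLog (Θ^[m]) (iterJoin Θ R m) (iterJoin Θ Q m) n =
        iterCoverLog Θ R Q (m * n) := by
      ext ω
      unfold iterCoverLog
      rw [iterJoin_mul, iterJoin_mul]
    rw [e, ← real_aux m n hm]
    exact mul_le_mul_right h2 _
  generalize (m : ℝ≥0∞) * relCoverEnt P Θ R Q = c at key ⊢
  unfold relCoverEnt
  refine le_limsup_of_frequently_le (Eventually.frequently ?_)
  filter_upwards [eventually_ge_atTop 1] with n hn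
  exact key n hn

theorem pow_pos_case {ϑ : Ω → Ω} {E : Set (Ω × X)} {T : Ω → X → X} (hE : MeasurableSet E)
    (hEc : ∀ ω, IsCompact (fib E ω))
    (hT : IsBundleRDS P ϑ E T) {Q : Set (Set (Ω × X))} (hQ : IsRandomCover E Q)
    (m : ℕ) (hm : 1 ≤ m) : condTailEnt P E ((skew ϑ T)^[m]) (iterJoin (skew ϑ T) Q m)
      = (m : ℝ≥0∞) * condTailEnt P E (skew ϑ T) Q := by
  have hs := sys_skew hT
  have hm0 : (m : ℝ≥0∞) ≠ 0 := by
    rw [Nat.cast_ne_zero]; omega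
  apply le_antisymm
  · conv_lhs => unfold condTailEnt
    refine iSup_le fun R => iSup_le fun hR => ?_
    refine trunc_le hE hEc (hs.pow m) hR (randomCover_iterJoin hs hQ m hm) _ ?_
    intro R' hR' hf
    exact (ent_le_aux hs hR'.1 hf hQ m hm).trans (mul_le_mul_right (le_condTailEnt hR') _)
  · rw [mul_comm, ← ENNReal.le_div_iff_mul_le (Or.inl hm0) (Or.inl (ENNReal.natCast_ne_top m))]
    conv_lhs => unfold condTailEnt
    refine iSup_le fun R => iSup_le fun hR => ?_
    refine trunc_le hE hEc hs hR hQ _ ?_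
    intro R' hR' hf
    rw [ENNReal.le_div_iff_mul_le (Or.inl hm0) (Or.inl (ENNReal.natCast_ne_top m)), mul_comm]
    exact (le_ent_aux hs hR'.1 hf hQ m hm).trans (le_condTailEnt (openCover_iterJoin hT hR' m hm))

end

/-- `h(Θ^m | Q^{(m)}) = m · h(Θ | Q)`. -/
theorem condTailEnt_pow
    {Ω X : Type*} [MeasurableSpace Ω] [MeasurableSpace.CountablyGenerated Ω]
    [MetricSpace X] [CompactSpace X] [MeasurableSpace X] [BorelSpace X]
    (P : Measure Ω) [IsProbabilityMeasure P] (hP : P.IsComplete)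
    (ϑ : Ω → Ω) (E : Set (Ω × X)) (hE : MeasurableSet E) (hEc : ∀ ω, IsCompact (fib E ω))
    (T : Ω → X → X) (hT : IsBundleRDS P ϑ E T)
    (Q : Set (Set (Ω × X))) (hQ : IsRandomCover E Q) (m : ℕ) :
    condTailEnt P E ((skew ϑ T)^[m]) (iterJoin (skew ϑ T) Q m)
      = (m : ℝ≥0∞) * condTailEnt P E (skew ϑ T) Q := by
  have := hP
  rcases Nat.eq_zero_or_pos m with rfl | hm
  · rw [pow_zero_case, Nat.cast_zero, zero_mul]
  · exact pow_pos_case hE hEc hT hQ m hm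

end RelTail
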